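/- arXiv:1001.2850 — 2 statements merged into one kernel-verified Lean document; each statement's English description precedes it below -/
import Mathlib

section
/- Let ε, μ ∈ (0,1], let h, b : ℝ² → ℝ be smooth with h bounded together with its derivatives, assume inf_{X∈ℝ²} h(X) ≥ h_min > 0, and let v : ℝ² → ℝ² be smooth with compact support. Then ∫_{ℝ²} (𝔗v)·v ≥ h_min |v|₂² + μ h_min | (h/√3) ∇·v - ε(√3/2) ∇b·v |₂² + (με² h_min/4) |∇b·v|₂² + μ |curl v|₂², where |·|₂ denotes the L²(ℝ²) norm. -/
open MeasureTheory

noncomputable section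

/-- Partial derivative in the first coordinate direction. -/
def pd1 (f : ℝ × ℝ → ℝ) (x : ℝ × ℝ) : ℝ := fderiv ℝ f x (1, 0)

/-- Partial derivative in the second coordinate direction. -/
def pd2 (f : ℝ × ℝ → ℝ) (x : ℝ × ℝ) : ℝ := fderiv ℝ f x (0, 1)

/-- Gradient of a scalar function on `ℝ²`. -/
def grad (f : ℝ × ℝ → ℝ) (x : ℝ × ℝ) : ℝ × ℝ := (pd1 f x, pd2 f x)

/-- Euclidean dot product on `ℝ²`. -/
def dot (a b : ℝ × ℝ) : ℝ := a.1 * b.1 + a.2 * b.2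

/-- Divergence of a vector field on `ℝ²`. -/
def divg (W : ℝ × ℝ → ℝ × ℝ) (x : ℝ × ℝ) : ℝ :=
  pd1 (fun y => (W y).1) x + pd2 (fun y => (W y).2) x

/-- Scalar curl of a vector field on `ℝ²`: `curl W = ∂₁W₂ - ∂₂W₁`. -/
def curl (W : ℝ × ℝ → ℝ × ℝ) (x : ℝ × ℝ) : ℝ :=
  pd1 (fun y => (W y).2) x - pd2 (fun y => (W y).1) x

/-- `∇⊥ f = (-∂₂ f, ∂₁ f)`. -/
def gradPerp (f : ℝ × ℝ → ℝ) (x : ℝ × ℝ) : ℝ × ℝ := (-(pd2 f x), pd1 f x)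

/-- The Green–Naghdi operator `𝒯[h, εb]`. -/
def Tcal (ε : ℝ) (h b : ℝ × ℝ → ℝ) (W : ℝ × ℝ → ℝ × ℝ) (x : ℝ × ℝ) : ℝ × ℝ :=
  (-(1/3 : ℝ)) • grad (fun y => (h y)^3 * divg W y) x
    + (ε/2) • (grad (fun y => (h y)^2 * dot (grad b y) (W y)) x
        - ((h x)^2 * divg W x) • grad b x)
    + (ε^2 * h x * dot (grad b x) (W x)) • grad b x

/-- The operator `𝔗 = h + μ(𝒯[h,εb] - ∇⊥ curl)`. -/
def Tfrak (ε μ : ℝ) (h b : ℝ × ℝ → ℝ) (W : ℝ × ℝ → ℝ × ℝ) (x : ℝ × ℝ) : ℝ × ℝ :=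
  h x • W x + μ • (Tcal ε h b W x - gradPerp (curl W) x)

lemma contDiff_pd1 {f : ℝ × ℝ → ℝ} (hf : ContDiff ℝ (⊤ : ℕ∞) f) :
    ContDiff ℝ (⊤ : ℕ∞) (pd1 f) := by
  unfold pd1
  exact (hf.fderiv_right (m := (⊤ : ℕ∞)) (by simp)).clm_apply contDiff_const

lemma contDiff_pd2 {f : ℝ × ℝ → ℝ} (hf : ContDiff ℝ (⊤ : ℕ∞) f) :
    ContDiff ℝ (⊤ : ℕ∞) (pd2 f) := by
  unfold pd2
  exact (hf.fderiv_right (m := (⊤ : ℕ∞)) (by simp)).clm_apply contDiff_const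

lemma contDiff_dot {V W : ℝ × ℝ → ℝ × ℝ} (hV : ContDiff ℝ (⊤ : ℕ∞) V)
    (hW : ContDiff ℝ (⊤ : ℕ∞) W) : ContDiff ℝ (⊤ : ℕ∞) (fun x => dot (V x) (W x)) :=
  (hV.fst.mul hW.fst).add (hV.snd.mul hW.snd)

lemma contDiff_grad {f : ℝ × ℝ → ℝ} (hf : ContDiff ℝ (⊤ : ℕ∞) f) :
    ContDiff ℝ (⊤ : ℕ∞) (grad f) :=
  (contDiff_pd1 hf).prodMk (contDiff_pd2 hf)

lemma contDiff_divg {W : ℝ × ℝ → ℝ × ℝ} (hW : ContDiff ℝ (⊤ : ℕ∞) W) :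
    ContDiff ℝ (⊤ : ℕ∞) (divg W) :=
  (contDiff_pd1 hW.fst).add (contDiff_pd2 hW.snd)

lemma contDiff_curl {W : ℝ × ℝ → ℝ × ℝ} (hW : ContDiff ℝ (⊤ : ℕ∞) W) :
    ContDiff ℝ (⊤ : ℕ∞) (curl W) :=
  (contDiff_pd1 hW.snd).sub (contDiff_pd2 hW.fst)

lemma pd1_mul {f g : ℝ × ℝ → ℝ} {x : ℝ × ℝ} (hf : DifferentiableAt ℝ f x)
    (hg : DifferentiableAt ℝ g x) :
    pd1 (fun y => f y * g y) x = f x * pd1 g x + g x * pd1 f x := by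
  simp [pd1, fderiv_fun_mul hf hg]

lemma pd2_mul {f g : ℝ × ℝ → ℝ} {x : ℝ × ℝ} (hf : DifferentiableAt ℝ f x)
    (hg : DifferentiableAt ℝ g x) :
    pd2 (fun y => f y * g y) x = f x * pd2 g x + g x * pd2 f x := by
  simp [pd2, fderiv_fun_mul hf hg]

lemma divg_smul {f : ℝ × ℝ → ℝ} {W : ℝ × ℝ → ℝ × ℝ} {x : ℝ × ℝ}
    (hf : DifferentiableAt ℝ f x) (hW : DifferentiableAt ℝ W x) :
    divg (fun y => f y • W y) x = f x * divg W x + dot (grad f x) (W x) := by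
  simp only [divg, Prod.smul_fst, Prod.smul_snd, smul_eq_mul, pd1_mul hf hW.fst,
    pd2_mul hf hW.snd, dot, grad]
  ring

lemma divg_smul_perp {f : ℝ × ℝ → ℝ} {W : ℝ × ℝ → ℝ × ℝ} {x : ℝ × ℝ}
    (hf : DifferentiableAt ℝ f x) (hW : DifferentiableAt ℝ W x) :
    divg (fun y => f y • ((W y).2, -(W y).1)) x
      = f x * curl W x + dot (gradPerp f x) (W x) := by
  have hneg : pd2 (fun y => f y * -(W y).1) x = -pd2 (fun y => f y * (W y).1) x := by
    simp [pd2]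
  simp only [divg, Prod.smul_fst, Prod.smul_snd, smul_eq_mul, pd1_mul hf hW.snd, hneg,
    pd2_mul hf hW.fst, dot, gradPerp, curl]
  ring

/-- The integral over `ℝ²` of a directional derivative of a compactly supported function is zero. -/
lemma integral_fderiv_apply_eq_zero {f : ℝ × ℝ → ℝ} (hf : ContDiff ℝ (⊤ : ℕ∞) f)
    (hfs : HasCompactSupport f) (w : ℝ × ℝ) : ∫ x, fderiv ℝ f x w = 0 := by
  have hd : Integrable (fun x => fderiv ℝ f x w) :=
    ((hf.continuous_fderiv (by simp)).clm_apply continuous_const).integrable_of_hasCompactSupport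
      (hfs.fderiv_apply (𝕜 := ℝ) w)
  have key := integral_mul_fderiv_eq_neg_fderiv_mul_of_integrable (μ := volume)
    (f := fun _ : ℝ × ℝ => (1 : ℝ)) (g := f) (v := w) (by simp) (by simpa using hd)
    (by simpa using hf.continuous.integrable_of_hasCompactSupport hfs)
    (fun _ _ => differentiableAt_const _) (fun x _ => hf.differentiable (by simp) x)
  simpa using key

/-- Divergence theorem on `ℝ²` for compactly supported fields. -/
lemma integral_divg_eq_zero {W : ℝ × ℝ → ℝ × ℝ} (hW : ContDiff ℝ (⊤ : ℕ∞) W)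
    (hWs : HasCompactSupport W) : ∫ x, divg W x = 0 := by
  have h1 : HasCompactSupport (fun y => (W y).1) := hWs.comp_left (g := Prod.fst) rfl
  have h2 : HasCompactSupport (fun y => (W y).2) := hWs.comp_left (g := Prod.snd) rfl
  have i1 : Integrable (pd1 fun y => (W y).1) :=
    (contDiff_pd1 hW.fst).continuous.integrable_of_hasCompactSupport (h1.fderiv_apply (𝕜 := ℝ) _)
  have i2 : Integrable (pd2 fun y => (W y).2) :=
    (contDiff_pd2 hW.snd).continuous.integrable_of_hasCompactSupport (h2.fderiv_apply (𝕜 := ℝ) _)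
  unfold divg
  rw [integral_add i1 i2]
  unfold pd1 pd2
  rw [integral_fderiv_apply_eq_zero hW.fst h1, integral_fderiv_apply_eq_zero hW.snd h2, add_zero]

lemma divg_eq_zero_of_notMem_tsupport {W : ℝ × ℝ → ℝ × ℝ} {x : ℝ × ℝ}
    (hx : x ∉ tsupport W) : divg W x = 0 := by
  have hW := notMem_tsupport_iff_eventuallyEq.mp hx
  have h1 : (fun y => (W y).1) =ᶠ[nhds x] fun _ => 0 := hW.mono fun y hy => by simp [hy]
  have h2 : (fun y => (W y).2) =ᶠ[nhds x] fun _ => 0 := hW.mono fun y hy => by simp [hy]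
  simp [divg, pd1, pd2, h1.fderiv_eq, h2.fderiv_eq]

lemma curl_eq_zero_of_notMem_tsupport {W : ℝ × ℝ → ℝ × ℝ} {x : ℝ × ℝ}
    (hx : x ∉ tsupport W) : curl W x = 0 := by
  have hW := notMem_tsupport_iff_eventuallyEq.mp hx
  have h1 : (fun y => (W y).1) =ᶠ[nhds x] fun _ => 0 := hW.mono fun y hy => by simp [hy]
  have h2 : (fun y => (W y).2) =ᶠ[nhds x] fun _ => 0 := hW.mono fun y hy => by simp [hy]
  simp [curl, pd1, pd2, h1.fderiv_eq, h2.fderiv_eq]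

/-- Pointwise form of the energy identity: `𝔗v · v` is a sum of squares up to a divergence. -/
lemma dot_Tfrak_eq {ε μ : ℝ} {h b : ℝ × ℝ → ℝ} {v : ℝ × ℝ → ℝ × ℝ}
    (hh : ContDiff ℝ (⊤ : ℕ∞) h) (hb : ContDiff ℝ (⊤ : ℕ∞) b) (hv : ContDiff ℝ (⊤ : ℕ∞) v)
    (x : ℝ × ℝ) :
    dot (Tfrak ε μ h b v x) (v x)
      = h x * dot (v x) (v x)
        + μ * h x * (h x / Real.sqrt 3 * divg v x
            - ε * (Real.sqrt 3 / 2) * dot (grad b x) (v x))^2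
        + μ * ε^2 * h x / 4 * (dot (grad b x) (v x))^2
        + μ * (curl v x)^2
        + μ * (-(1/3) * divg (fun y => ((h y)^3 * divg v y) • v y) x
          + ε/2 * divg (fun y => ((h y)^2 * dot (grad b y) (v y)) • v y) x
          - divg (fun y => curl v y • ((v y).2, -(v y).1)) x) := by
  have dv : DifferentiableAt ℝ v x := hv.differentiable (by simp) x
  have d1 : DifferentiableAt ℝ (fun y => (h y)^3 * divg v y) x :=
    ((hh.pow 3).mul (contDiff_divg hv)).differentiable (by simp) x
  have d2 : DifferentiableAt ℝ (fun y => (h y)^2 * dot (grad b y) (v y)) x :=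
    ((hh.pow 2).mul (contDiff_dot (contDiff_grad hb) hv)).differentiable (by simp) x
  have d3 : DifferentiableAt ℝ (curl v) x := (contDiff_curl hv).differentiable (by simp) x
  rw [divg_smul d1 dv, divg_smul d2 dv, divg_smul_perp d3 dv]
  have hsq : (h x / Real.sqrt 3 * divg v x
      - ε * (Real.sqrt 3 / 2) * dot (grad b x) (v x))^2
      = (h x)^2 / 3 * (divg v x)^2 - ε * h x * divg v x * dot (grad b x) (v x)
        + 3 / 4 * ε^2 * (dot (grad b x) (v x))^2 := by
    have h3 : Real.sqrt 3 ^ 2 = 3 := Real.sq_sqrt (by norm_num)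
    have h0 : Real.sqrt 3 ≠ 0 := by positivity
    have hd : h x / Real.sqrt 3 = h x * Real.sqrt 3 / 3 := by
      rw [div_eq_div_iff h0 (by norm_num)]
      linear_combination -h x * h3
    rw [hd]
    linear_combination (h x / 3 * divg v x - ε / 2 * dot (grad b x) (v x))^2 * h3
  rw [hsq]
  simp only [Tfrak, Tcal]
  generalize grad (fun y => (h y)^3 * divg v y) x = P
  generalize grad (fun y => (h y)^2 * dot (grad b y) (v y)) x = Q
  simp only [dot, Prod.fst_add, Prod.snd_add, Prod.fst_sub, Prod.snd_sub, Prod.smul_fst,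
    Prod.smul_snd, smul_eq_mul]
  ring

/-- Coercivity of `𝔗` (proof of Lemma 2): `(𝔗v, v) ≥ E(εb, v)` under the
nonzero-depth condition `h ≥ h_min > 0`. -/
theorem Tfrak_coercivity (ε μ : ℝ) (hε : ε ∈ Set.Ioc (0:ℝ) 1)
    (hμ : μ ∈ Set.Ioc (0:ℝ) 1)
    (h b : ℝ × ℝ → ℝ) (hh : ContDiff ℝ (⊤ : ℕ∞) h) (hb : ContDiff ℝ (⊤ : ℕ∞) b)
    (hhbd : ∀ n : ℕ, ∃ C : ℝ, ∀ x, ‖iteratedFDeriv ℝ n h x‖ ≤ C)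
    (hmin : ℝ) (hmin_pos : 0 < hmin) (hinf : ∀ x, hmin ≤ h x)
    (v : ℝ × ℝ → ℝ × ℝ) (hv : ContDiff ℝ (⊤ : ℕ∞) v) (hvs : HasCompactSupport v) :
    (∫ x : ℝ × ℝ, dot (Tfrak ε μ h b v x) (v x))
      ≥ hmin * (∫ x : ℝ × ℝ, dot (v x) (v x))
        + μ * hmin * (∫ x : ℝ × ℝ,
            (h x / Real.sqrt 3 * divg v x
              - ε * (Real.sqrt 3 / 2) * dot (grad b x) (v x))^2)
        + μ * ε^2 * hmin / 4 * (∫ x : ℝ × ℝ, (dot (grad b x) (v x))^2)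
        + μ * ∫ x : ℝ × ℝ, (curl v x)^2 := by
  obtain ⟨hμ0, -⟩ := hμ
  have hv0 : ∀ x ∉ tsupport v, v x = 0 := fun x hx => image_eq_zero_of_notMem_tsupport hx
  have cs : ∀ {f : ℝ × ℝ → ℝ}, ContDiff ℝ (⊤ : ℕ∞) f → (∀ x ∉ tsupport v, f x = 0) →
      Integrable f := fun hf h0 =>
    hf.continuous.integrable_of_hasCompactSupport (HasCompactSupport.intro hvs h0)
  have sD := contDiff_divg hv
  have sC := contDiff_curl hv
  have sB := contDiff_dot (contDiff_grad hb) hv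
  have sv := contDiff_dot hv hv
  have sS : ContDiff ℝ (⊤ : ℕ∞) (fun x => (h x / Real.sqrt 3 * divg v x
      - ε * (Real.sqrt 3 / 2) * dot (grad b x) (v x))^2) :=
    (((hh.div_const _).mul sD).sub (contDiff_const.mul sB)).pow 2
  have zD : ∀ x ∉ tsupport v, divg v x = 0 := fun x => divg_eq_zero_of_notMem_tsupport
  have zC : ∀ x ∉ tsupport v, curl v x = 0 := fun x => curl_eq_zero_of_notMem_tsupport
  have zB : ∀ x ∉ tsupport v, dot (grad b x) (v x) = 0 := fun x hx => by simp [dot, hv0 x hx]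
  have zv : ∀ x ∉ tsupport v, dot (v x) (v x) = 0 := fun x hx => by simp [dot, hv0 x hx]
  have zS : ∀ x ∉ tsupport v, (h x / Real.sqrt 3 * divg v x
      - ε * (Real.sqrt 3 / 2) * dot (grad b x) (v x))^2 = 0 :=
    fun x hx => by simp [zD x hx, zB x hx]
  have iv := cs sv zv
  have iS := cs sS zS
  have iB := cs (sB.pow 2) fun x hx => by simp [zB x hx]
  have iC := cs (sC.pow 2) fun x hx => by simp [zC x hx]
  have ihv := cs (hh.mul sv) fun x hx => by simp [zv x hx]
  have ihS := cs ((contDiff_const (c := μ)).mul hh |>.mul sS) fun x hx => by simp [zS x hx]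
  have ihB := cs ((((contDiff_const (c := μ * ε^2)).mul hh).div_const 4).mul (sB.pow 2))
    fun x hx => by simp [zB x hx]
  have field : ∀ {W : ℝ × ℝ → ℝ × ℝ}, ContDiff ℝ (⊤ : ℕ∞) W → (∀ x ∉ tsupport v, W x = 0) →
      Integrable (divg W) ∧ ∫ x, divg W x = 0 := by
    intro W hW h0
    have hsub : tsupport W ⊆ tsupport v :=
      closure_minimal (fun x hx => by_contra fun hn => hx (h0 x hn)) (isClosed_tsupport v)
    exact ⟨cs (contDiff_divg hW) fun x hx => divg_eq_zero_of_notMem_tsupport fun hn => hx (hsub hn),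
      integral_divg_eq_zero hW (HasCompactSupport.intro hvs h0)⟩
  obtain ⟨j1, e1⟩ := field (W := fun y => ((h y)^3 * divg v y) • v y)
    (((hh.pow 3).mul sD).smul hv) fun x hx => by simp [hv0 x hx]
  obtain ⟨j2, e2⟩ := field (W := fun y => ((h y)^2 * dot (grad b y) (v y)) • v y)
    (((hh.pow 2).mul sB).smul hv) fun x hx => by simp [hv0 x hx]
  obtain ⟨j3, e3⟩ := field (W := fun y => curl v y • ((v y).2, -(v y).1))
    (sC.smul (hv.snd.prodMk hv.fst.neg)) fun x hx => by simp [hv0 x hx]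
  have iQ := ((ihv.fun_add ihS).fun_add ihB).fun_add (iC.const_mul μ)
  have iF : Integrable fun x => μ * (-(1/3) * divg (fun y => ((h y)^3 * divg v y) • v y) x
          + ε/2 * divg (fun y => ((h y)^2 * dot (grad b y) (v y)) • v y) x
          - divg (fun y => curl v y • ((v y).2, -(v y).1)) x) :=
    (((j1.const_mul (-(1/3))).fun_add (j2.const_mul (ε/2))).sub j3).const_mul μ
  have iR := (((iv.const_mul hmin).fun_add (iS.const_mul (μ * hmin))).fun_add
    (iB.const_mul (μ * ε^2 * hmin / 4))).fun_add (iC.const_mul μ)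
  have eF : ∫ x, μ * (-(1/3) * divg (fun y => ((h y)^3 * divg v y) • v y) x
          + ε/2 * divg (fun y => ((h y)^2 * dot (grad b y) (v y)) • v y) x
          - divg (fun y => curl v y • ((v y).2, -(v y).1)) x) = 0 := by
    rw [integral_const_mul, integral_sub ((j1.const_mul _).fun_add (j2.const_mul _)) j3,
      integral_add (j1.const_mul _) (j2.const_mul _), integral_const_mul, integral_const_mul,
      e1, e2, e3]
    simp
  simp_rw [dot_Tfrak_eq hh hb hv]
  rw [integral_add iQ iF, eF, add_zero]
  simp_rw [← integral_const_mul]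
  rw [← integral_add (iv.const_mul _) (iS.const_mul _),
    ← integral_add ((iv.const_mul _).fun_add (iS.const_mul _)) (iB.const_mul _),
    ← integral_add (((iv.const_mul _).fun_add (iS.const_mul _)).fun_add (iB.const_mul _))
      (iC.const_mul _)]
  refine integral_mono iR iQ fun x => ?_
  have hx := hinf x
  have nv : 0 ≤ dot (v x) (v x) := add_nonneg (mul_self_nonneg _) (mul_self_nonneg _)
  gcongr

end
end

section
/- Let u = (U₁,U₂) : ℝ² → ℝ² be a smooth vector field with bounded derivatives and w = (w₁,w₂) : ℝ² → ℝ² be smooth with compact support. Then ∫_{ℝ²} curl((u·∇)w) · curl w = -(1/2) ∫_{ℝ²} (∂₁U₁)(curl w)² - (1/2) ∫_{ℝ²} (∂₂U₂)(curl w)² + ∫_{ℝ²} (curl w)(∂₁u·∇w₂) - ∫_{ℝ²} (curl w)(∂₂u·∇w₁), where (u·∇)w = (U₁∂₁w₁ + U₂∂₂w₁, U₁∂₁w₂ + U₂∂₂w₂), curl w = ∂₁w₂ - ∂₂w₁, ∂ⱼu = (∂ⱼU₁, ∂ⱼU₂) and ∇wᵢ = (∂₁wᵢ, ∂₂wᵢ).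 -/
open MeasureTheory

noncomputable section

/-- The advection term `(u·∇)w`, componentwise. -/
def advect (u w : ℝ × ℝ → ℝ × ℝ) (y : ℝ × ℝ) : ℝ × ℝ :=
  (dot (u y) (grad (fun z => (w z).1) y), dot (u y) (grad (fun z => (w z).2) y))

/-- `∂₁u = (∂₁U₁, ∂₁U₂)`. -/
def pdv1 (u : ℝ × ℝ → ℝ × ℝ) (x : ℝ × ℝ) : ℝ × ℝ :=
  (pd1 (fun y => (u y).1) x, pd1 (fun y => (u y).2) x)

/-- `∂₂u = (∂₂U₁, ∂₂U₂)`. -/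
def pdv2 (u : ℝ × ℝ → ℝ × ℝ) (x : ℝ × ℝ) : ℝ × ℝ :=
  (pd2 (fun y => (u y).1) x, pd2 (fun y => (u y).2) x)

section DirectionalDerivative

variable {E : Type*} [NormedAddCommGroup E] [NormedSpace ℝ E]

theorem contDiff_fderiv_apply_const {f : E → ℝ} (hf : ContDiff ℝ (⊤ : ℕ∞) f) (v : E) :
    ContDiff ℝ (⊤ : ℕ∞) (fun x => fderiv ℝ f x v) :=
  (hf.fderiv_right (m := (⊤ : ℕ∞)) (by simp)).clm_apply contDiff_const

theorem fderiv_fderiv_apply_comm {f : E → ℝ} (hf : ContDiff ℝ (⊤ : ℕ∞) f) (v w x : E) :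
    fderiv ℝ (fun y => fderiv ℝ f y v) x w = fderiv ℝ (fun y => fderiv ℝ f y w) x v := by
  have hd : DifferentiableAt ℝ (fderiv ℝ f) x :=
    ((hf.fderiv_right (m := (⊤ : ℕ∞)) (by simp)).differentiable (by simp)) x
  have h : ∀ a b : E,
      fderiv ℝ (fun y => fderiv ℝ f y a) x b = fderiv ℝ (fderiv ℝ f) x b a := by
    intro a b
    rw [fderiv_clm_apply hd (differentiableAt_const a)]
    simp
  rw [h, h]
  exact (hf.contDiffAt.isSymmSndFDerivAt
    (by rw [minSmoothness_of_isRCLikeNormedField]; exact WithTop.coe_le_coe.2 (le_top (a := (2 : ℕ∞))))).eq w v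

theorem fderiv_mul_apply {f g : E → ℝ} {x : E} (hf : DifferentiableAt ℝ f x)
    (hg : DifferentiableAt ℝ g x) (v : E) :
    fderiv ℝ (fun y => f y * g y) x v = fderiv ℝ f x v * g x + f x * fderiv ℝ g x v := by
  rw [fderiv_fun_mul hf hg]
  simp
  ring

theorem fderiv_mul_add_mul_apply {a b f g : E → ℝ} (ha : ContDiff ℝ (⊤ : ℕ∞) a)
    (hb : ContDiff ℝ (⊤ : ℕ∞) b) (hf : ContDiff ℝ (⊤ : ℕ∞) f) (hg : ContDiff ℝ (⊤ : ℕ∞) g)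
    (x v : E) :
    fderiv ℝ (fun y => a y * f y + b y * g y) x v =
      fderiv ℝ a x v * f x + a x * fderiv ℝ f x v
        + (fderiv ℝ b x v * g x + b x * fderiv ℝ g x v) := by
  have diff : ∀ {h : E → ℝ}, ContDiff ℝ (⊤ : ℕ∞) h → DifferentiableAt ℝ h x :=
    fun h => h.differentiable (by simp) x
  rw [fderiv_fun_add ((diff ha).fun_mul (diff hf)) ((diff hb).fun_mul (diff hg)),
    add_apply, fderiv_mul_apply (diff ha) (diff hf), fderiv_mul_apply (diff hb) (diff hg)]

theorem integral_fderiv_apply_eq_zero_s6 [FiniteDimensional ℝ E] [MeasurableSpace E] [BorelSpace E]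
    (μ : Measure E) [μ.IsAddHaarMeasure] {f : E → ℝ} (hf : ContDiff ℝ (⊤ : ℕ∞) f)
    (hfs : HasCompactSupport f) (v : E) : ∫ x, fderiv ℝ f x v ∂μ = 0 := by
  have hi : Integrable f μ := hf.continuous.integrable_of_hasCompactSupport hfs
  have hi' : Integrable (fun x => fderiv ℝ f x v) μ :=
    (contDiff_fderiv_apply_const hf v).continuous.integrable_of_hasCompactSupport
      (hfs.fderiv_apply ℝ v)
  simpa using integral_mul_fderiv_eq_neg_fderiv_mul_of_integrable (μ := μ) (v := v)
    (f := fun _ : E => (1 : ℝ)) (g := f) (by simp) (by simpa using hi') (by simpa using hi)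
    (fun x _ => differentiableAt_const _) (fun x _ => hf.differentiable (by simp) x)

/-- Integration by parts against a transported square. -/
theorem integral_mul_mul_fderiv_apply [FiniteDimensional ℝ E] [MeasurableSpace E] [BorelSpace E]
    (μ : Measure E) [μ.IsAddHaarMeasure] {a f : E → ℝ} (ha : ContDiff ℝ (⊤ : ℕ∞) a)
    (hf : ContDiff ℝ (⊤ : ℕ∞) f) (hfs : HasCompactSupport f) (v : E) :
    ∫ x, a x * f x * fderiv ℝ f x v ∂μ = -(1 / 2) * ∫ x, fderiv ℝ a x v * f x ^ 2 ∂μ := by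
  have hf2s : HasCompactSupport (fun x => f x * f x) := hfs.mul_left
  have hzero := integral_fderiv_apply_eq_zero_s6 μ (ha.mul (hf.mul hf)) hf2s.mul_left v
  have hi₁ : Integrable (fun x => fderiv ℝ a x v * f x ^ 2) μ := by
    simp only [pow_two]
    exact ((contDiff_fderiv_apply_const ha v).continuous.mul
      (hf.continuous.mul hf.continuous)).integrable_of_hasCompactSupport hf2s.mul_left
  have hi₂ : Integrable (fun x => a x * f x * fderiv ℝ f x v) μ :=
    ((ha.continuous.mul hf.continuous).mul
      (contDiff_fderiv_apply_const hf v).continuous).integrable_of_hasCompactSupport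
      (hfs.fderiv_apply ℝ v).mul_left
  have hpt : ∀ x, fderiv ℝ (fun y => a y * (f y * f y)) x v =
      fderiv ℝ a x v * f x ^ 2 + 2 * (a x * f x * fderiv ℝ f x v) := by
    intro x
    have hfx := hf.differentiable (by simp) x
    rw [fderiv_mul_apply (ha.differentiable (by simp) x) (hfx.fun_mul hfx), fderiv_mul_apply hfx hfx]
    ring
  simp_rw [hpt] at hzero
  rw [integral_add hi₁ (hi₂.const_mul 2), integral_const_mul] at hzero
  linarith

end DirectionalDerivative

theorem curl_advect {u w : ℝ × ℝ → ℝ × ℝ} (hu : ContDiff ℝ (⊤ : ℕ∞) u)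
    (hw : ContDiff ℝ (⊤ : ℕ∞) w) (x : ℝ × ℝ) :
    curl (advect u w) x = dot (u x) (grad (curl w) x)
      + dot (pdv1 u x) (grad (fun y => (w y).2) x)
      - dot (pdv2 u x) (grad (fun y => (w y).1) x) := by
  have hc₁ := contDiff_fderiv_apply_const hw.fst
  have hc₂ := contDiff_fderiv_apply_const hw.snd
  have hcurl : ∀ v, fderiv ℝ (curl w) x v =
      fderiv ℝ (fun y => fderiv ℝ (fun z => (w z).2) y (1, 0)) x v
        - fderiv ℝ (fun y => fderiv ℝ (fun z => (w z).1) y (0, 1)) x v := by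
    intro v
    have h := fderiv_fun_sub ((hc₂ (1, 0)).differentiable (by simp) x)
      ((hc₁ (0, 1)).differentiable (by simp) x)
    exact congrArg (fun L => L v) h
  simp only [curl, advect, dot, grad, pdv1, pdv2, pd1, pd2] at hcurl ⊢
  rw [fderiv_mul_add_mul_apply hu.fst hu.snd (hc₂ _) (hc₂ _),
    fderiv_mul_add_mul_apply hu.fst hu.snd (hc₁ _) (hc₁ _), hcurl, hcurl,
    fderiv_fderiv_apply_comm hw.snd (0, 1) (1, 0), fderiv_fderiv_apply_comm hw.fst (1, 0) (0, 1)]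
  ring

/-- The integration-by-parts identity for `∫ curl((u·∇)w) · curl w` used in the
control of `A₄₁` in Proposition 1. -/
theorem curl_advect_integration_by_parts (u w : ℝ × ℝ → ℝ × ℝ)
    (hu : ContDiff ℝ (⊤ : ℕ∞) u)
    (hubd : ∀ n : ℕ, ∃ C : ℝ, ∀ x, ‖iteratedFDeriv ℝ (n + 1) u x‖ ≤ C)
    (hw : ContDiff ℝ (⊤ : ℕ∞) w) (hws : HasCompactSupport w) :
    ∫ x : ℝ × ℝ, curl (advect u w) x * curl w x
      = -(1/2) * (∫ x : ℝ × ℝ, pd1 (fun y => (u y).1) x * (curl w x)^2)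
        - (1/2) * (∫ x : ℝ × ℝ, pd2 (fun y => (u y).2) x * (curl w x)^2)
        + (∫ x : ℝ × ℝ, curl w x * dot (pdv1 u x) (grad (fun y => (w y).2) x))
        - ∫ x : ℝ × ℝ, curl w x * dot (pdv2 u x) (grad (fun y => (w y).1) x) := by
  have hw₁s : HasCompactSupport (fun x => (w x).1) := hws.comp_left (g := Prod.fst) rfl
  have hw₂s : HasCompactSupport (fun x => (w x).2) := hws.comp_left (g := Prod.snd) rfl
  have hω : ContDiff ℝ (⊤ : ℕ∞) (curl w) :=
    (contDiff_fderiv_apply_const hw.snd _).sub (contDiff_fderiv_apply_const hw.fst _)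
  have hωs : HasCompactSupport (curl w) :=
    (hw₂s.fderiv_apply ℝ (1, 0)).sub (hw₁s.fderiv_apply ℝ (0, 1))
  have hint : ∀ {f : ℝ × ℝ → ℝ}, Continuous f → Integrable (fun x => curl w x * f x) :=
    fun hf => (hω.continuous.mul hf).integrable_of_hasCompactSupport hωs.mul_right
  have hcont : ∀ {f : ℝ × ℝ → ℝ}, ContDiff ℝ (⊤ : ℕ∞) f →
      ∀ v, Continuous (fun x => fderiv ℝ f x v) :=
    fun hf v => (contDiff_fderiv_apply_const hf v).continuous
  have hi₁ : Integrable (fun x => (u x).1 * curl w x * pd1 (curl w) x) :=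
    (hint (hu.fst.continuous.mul (hcont hω (1, 0)))).congr (.of_forall fun x => by
      simp only [pd1, Pi.mul_apply]; ring)
  have hi₂ : Integrable (fun x => (u x).2 * curl w x * pd2 (curl w) x) :=
    (hint (hu.snd.continuous.mul (hcont hω (0, 1)))).congr (.of_forall fun x => by
      simp only [pd2, Pi.mul_apply]; ring)
  have hi₃ : Integrable (fun x => curl w x * dot (pdv1 u x) (grad (fun y => (w y).2) x)) :=
    hint (((hcont hu.fst _).mul (hcont hw.snd _)).add ((hcont hu.snd _).mul (hcont hw.snd _)))
  have hi₄ : Integrable (fun x => curl w x * dot (pdv2 u x) (grad (fun y => (w y).1) x)) :=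
    hint (((hcont hu.fst _).mul (hcont hw.fst _)).add ((hcont hu.snd _).mul (hcont hw.fst _)))
  have hpt : ∀ x, curl (advect u w) x * curl w x =
      (u x).1 * curl w x * pd1 (curl w) x + (u x).2 * curl w x * pd2 (curl w) x
        + curl w x * dot (pdv1 u x) (grad (fun y => (w y).2) x)
        - curl w x * dot (pdv2 u x) (grad (fun y => (w y).1) x) := by
    intro x
    rw [curl_advect hu hw x]
    simp only [dot, grad]
    ring
  have hp₁ : ∫ x, (u x).1 * curl w x * pd1 (curl w) x =
      -(1 / 2) * ∫ x, pd1 (fun y => (u y).1) x * curl w x ^ 2 :=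
    integral_mul_mul_fderiv_apply volume hu.fst hω hωs (1, 0)
  have hp₂ : ∫ x, (u x).2 * curl w x * pd2 (curl w) x =
      -(1 / 2) * ∫ x, pd2 (fun y => (u y).2) x * curl w x ^ 2 :=
    integral_mul_mul_fderiv_apply volume hu.snd hω hωs (0, 1)
  simp_rw [hpt]
  rw [integral_sub ((hi₁.fun_add hi₂).fun_add hi₃) hi₄, integral_add (hi₁.fun_add hi₂) hi₃,
    integral_add hi₁ hi₂, hp₁, hp₂]
  ring

end
end
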